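/- arXiv:2401.01396 — 6 statements merged into one kernel-verified Lean document; each statement's English description precedes it below -/
import Mathlib

section
/- For every ν ∈ (0,1) and every real c, the limit lim_{t→∞} (1/t) · log E_ν(c t^ν) exists and equals (max(c,0))^{1/ν}; in particular, the limit equals c^{1/ν} if c ≥ 0 and equals 0 if c < 0. -/
open Filter

noncomputable def mittagLeffler (ν x : ℝ) : ℝ := ∑' k : ℕ, x ^ k / Real.Gamma (ν * k + 1)

open MeasureTheory in
/-- Truncating the Gamma integral to `[R, ∞)` gives a lower bound. -/
lemma rpow_mul_exp_neg_le_Gamma {a R : ℝ} (ha : 0 ≤ a) (hR : 0 < R) :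
    R ^ a * Real.exp (-R) ≤ Real.Gamma (a + 1) := by
  have hint := Real.GammaIntegral_convergent (s := a + 1) (by positivity)
  rw [Real.Gamma_eq_integral (by positivity), ← integral_exp_neg_Ioi, ← integral_const_mul]
  simp only [add_sub_cancel_right] at hint ⊢
  have hsub : Set.Ioi R ⊆ Set.Ioi 0 := Set.Ioi_subset_Ioi hR.le
  calc ∫ u in Set.Ioi R, R ^ a * Real.exp (-u)
      ≤ ∫ u in Set.Ioi R, Real.exp (-u) * u ^ a := by
        refine setIntegral_mono_on ?_ (hint.mono_set hsub) measurableSet_Ioi fun u hu => ?_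
        · have := exp_neg_integrableOn_Ioi R one_pos
          simp only [neg_mul, one_mul] at this
          exact this.const_mul _
        · rw [mul_comm]
          gcongr
          exact le_of_lt hu
    _ ≤ ∫ u in Set.Ioi 0, Real.exp (-u) * u ^ a := by
        refine setIntegral_mono_set hint ?_ hsub.eventuallyLE
        filter_upwards [ae_restrict_mem measurableSet_Ioi] with u hu
        have : 0 < u := hu
        simp only [Pi.zero_apply]
        positivity

open MeasureTheory in
/-- An upper bound for the Gamma function coming from `u / T ≤ exp (u / T - 1)`. -/
lemma Gamma_add_one_le {a T : ℝ} (ha : 0 ≤ a) (haT : a < T) :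
    Real.Gamma (a + 1) ≤ T ^ a * Real.exp (-a) / (1 - a / T) := by
  have hT : 0 < T := ha.trans_lt haT
  have hd : 0 < 1 - a / T := by
    rw [sub_pos, div_lt_one hT]
    exact haT
  have hint := Real.GammaIntegral_convergent (s := a + 1) (by positivity)
  have key : ∫ u in Set.Ioi (0 : ℝ), T ^ a * Real.exp (-a) * Real.exp (-(1 - a / T) * u) =
      T ^ a * Real.exp (-a) / (1 - a / T) := by
    rw [integral_const_mul, integral_exp_mul_Ioi (neg_lt_zero.2 hd)]
    simp only [mul_zero, Real.exp_zero, neg_div_neg_eq]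
    ring
  rw [Real.Gamma_eq_integral (by positivity), ← key]
  simp only [add_sub_cancel_right] at hint ⊢
  refine setIntegral_mono_on hint ((exp_neg_integrableOn_Ioi 0 hd).const_mul _)
    measurableSet_Ioi fun u hu => ?_
  have hu0 : 0 < u := hu
  have h1 : u / T ≤ Real.exp (u / T - 1) := by
    have := Real.add_one_le_exp (u / T - 1)
    linarith
  have h2 : u ^ a ≤ T ^ a * Real.exp ((u / T - 1) * a) := by
    calc u ^ a = T ^ a * (u / T) ^ a := by
          rw [← Real.mul_rpow hT.le (by positivity), mul_div_cancel₀ _ hT.ne']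
      _ ≤ T ^ a * Real.exp (u / T - 1) ^ a := by gcongr
      _ = _ := by rw [← Real.exp_mul]
  calc Real.exp (-u) * u ^ a ≤ Real.exp (-u) * (T ^ a * Real.exp ((u / T - 1) * a)) := by gcongr
    _ = T ^ a * (Real.exp (-u) * Real.exp ((u / T - 1) * a)) := by ring
    _ = T ^ a * (Real.exp (-a) * Real.exp (-(1 - a / T) * u)) := by
        rw [← Real.exp_add, ← Real.exp_add]
        ring_nf
    _ = _ := by ring

lemma rpow_natCast_mul_div_Gamma_le {ν T R : ℝ} (hν : 0 < ν) (hT : 0 ≤ T) (hR : 0 < R) (k : ℕ) :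
    (T ^ ν) ^ k / Real.Gamma (ν * k + 1) ≤ Real.exp R * ((T / R) ^ ν) ^ k := by
  have ha : 0 ≤ ν * k := by positivity
  rw [div_le_iff₀ (Real.Gamma_pos_of_pos (by positivity))]
  calc (T ^ ν) ^ k = Real.exp R * ((T / R) ^ ν) ^ k * (R ^ (ν * k) * Real.exp (-R)) := by
        rw [Real.div_rpow hT hR.le, div_pow, Real.rpow_mul_natCast hR.le, Real.exp_neg]
        field_simp
    _ ≤ _ := by
        gcongr
        exact rpow_mul_exp_neg_le_Gamma ha hR

lemma rpow_div_lt_one {ν T R : ℝ} (hν : 0 < ν) (hT : 0 ≤ T) (hR : T < R) : (T / R) ^ ν < 1 := by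
  have hR0 : 0 < R := hT.trans_lt hR
  exact Real.rpow_lt_one (by positivity) ((div_lt_one hR0).2 hR) hν

lemma summable_mittagLeffler {ν : ℝ} (hν : 0 < ν) {x : ℝ} (hx : 0 ≤ x) :
    Summable fun k : ℕ => x ^ k / Real.Gamma (ν * k + 1) := by
  obtain ⟨T, hT, rfl⟩ : ∃ T : ℝ, 0 ≤ T ∧ T ^ ν = x :=
    ⟨x ^ ν⁻¹, by positivity, Real.rpow_inv_rpow hx hν.ne'⟩
  have hR : 0 < T + 1 := by positivity
  refine .of_nonneg_of_le (fun k => ?_)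
    (fun k => rpow_natCast_mul_div_Gamma_le hν hT hR k) (.mul_left _ ?_)
  · have := Real.Gamma_pos_of_pos (show 0 < ν * k + 1 by positivity)
    positivity
  · exact summable_geometric_of_lt_one (by positivity) (rpow_div_lt_one hν hT (by linarith))

lemma mittagLeffler_rpow_le {ν T R : ℝ} (hν : 0 < ν) (hT : 0 ≤ T) (hR : T < R) :
    mittagLeffler ν (T ^ ν) ≤ Real.exp R * (1 - (T / R) ^ ν)⁻¹ := by
  have hR0 : 0 < R := hT.trans_lt hR
  have h1 := rpow_div_lt_one hν hT hR
  have h0 : 0 ≤ (T / R) ^ ν := by positivity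
  rw [← tsum_geometric_of_lt_one h0 h1, ← tsum_mul_left]
  exact (summable_mittagLeffler hν (by positivity)).tsum_le_tsum
    (rpow_natCast_mul_div_Gamma_le hν hT hR0) ((summable_geometric_of_lt_one h0 h1).mul_left _)

lemma le_mittagLeffler_rpow {ν T θ : ℝ} (hν : ν ∈ Set.Ioo (0 : ℝ) 1) (hT : 0 < T)
    (hθ : θ ∈ Set.Ioo (0 : ℝ) 1) :
    (1 - θ) * Real.exp (θ * T - 1) ≤ mittagLeffler ν (T ^ ν) := by
  obtain ⟨hν0, hν1⟩ := hν
  obtain ⟨hθ0, hθ1⟩ := hθ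
  set k : ℕ := ⌊θ * T / ν⌋₊
  have hk1 : ν * k ≤ θ * T := by
    have := Nat.floor_le (show 0 ≤ θ * T / ν by positivity)
    rwa [le_div_iff₀' hν0] at this
  have hk2 : θ * T - 1 ≤ ν * k := by
    have := Nat.lt_floor_add_one (θ * T / ν)
    rw [div_lt_iff₀' hν0] at this
    linarith
  have ha : 0 ≤ ν * k := by positivity
  have hG := Gamma_add_one_le ha (show ν * k < T by nlinarith)
  have hGpos := Real.Gamma_pos_of_pos (show 0 < ν * k + 1 by positivity)
  have hd : 1 - θ ≤ 1 - ν * k / T := by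
    have := (div_le_iff₀ hT).2 hk1
    linarith
  have hd0 : 0 < 1 - ν * k / T := by linarith
  refine le_trans ?_ ((summable_mittagLeffler hν0 (by positivity)).le_tsum k fun j _ => ?_)
  · rw [le_div_iff₀ hGpos, ← Real.rpow_mul_natCast hT.le]
    calc (1 - θ) * Real.exp (θ * T - 1) * Real.Gamma (ν * k + 1)
        ≤ (1 - ν * k / T) * Real.exp (ν * k) *
          (T ^ (ν * k) * Real.exp (-(ν * k)) / (1 - ν * k / T)) := by
          gcongr
      _ = T ^ (ν * k) := by
          generalize 1 - ν * k / T = d at hd0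
          have := hd0.ne'
          rw [Real.exp_neg]
          field_simp
  · have := Real.Gamma_pos_of_pos (show 0 < ν * j + 1 by positivity)
    positivity

/-- After scaling by `n ^ ((1 - ν) * k)`, these products converge to `k! / Γ (ν * k + 1)`; for each
fixed `n` and `ν ∈ [0, 1]` they are the moments of a product of independent `[0, 1]`-valued random
variables. -/
noncomputable def momentProd (ν : ℝ) (n k : ℕ) : ℝ :=
  ∏ j ∈ Finset.range n, (j + 1 + ν * k) / (j + 1 + k)

lemma momentProd_succ (ν : ℝ) (n k : ℕ) :
    momentProd ν (n + 1) k = momentProd ν n k * ((n + 1 + ν * k) / (n + 1 + k)) :=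
  Finset.prod_range_succ _ _

lemma momentProd_nonneg {ν : ℝ} (hν : 0 ≤ ν) (n k : ℕ) : 0 ≤ momentProd ν n k :=
  Finset.prod_nonneg fun _ _ => by positivity

lemma momentProd_le_one {ν : ℝ} (hν : ν ∈ Set.Icc (0 : ℝ) 1) (n k : ℕ) : momentProd ν n k ≤ 1 := by
  obtain ⟨h0, h1⟩ := hν
  refine Finset.prod_le_one (fun _ _ => by positivity) fun j _ => ?_
  rw [div_le_one (by positivity)]
  gcongr
  exact mul_le_of_le_one_left (by positivity) h1

/-- The Laplace transform of the distribution with moments `momentProd ν n`. -/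
noncomputable def momentLaplace (ν : ℝ) (n : ℕ) (x : ℝ) : ℝ :=
  ∑' k : ℕ, (-x) ^ k / k.factorial * momentProd ν n k

lemma norm_momentLaplace_term_le {ν : ℝ} (hν : ν ∈ Set.Icc (0 : ℝ) 1) (n k : ℕ) {x y : ℝ}
    (hxy : |x| ≤ y) : ‖(-x) ^ k / k.factorial * momentProd ν n k‖ ≤ y ^ k / k.factorial := by
  rw [norm_mul, norm_div, norm_pow, norm_neg, Real.norm_eq_abs, Real.norm_natCast,
    Real.norm_of_nonneg (momentProd_nonneg hν.1 n k)]
  refine (mul_le_of_le_one_right (by positivity) (momentProd_le_one hν n k)).trans ?_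
  gcongr

lemma hasSum_momentLaplace {ν : ℝ} (hν : ν ∈ Set.Icc (0 : ℝ) 1) (n : ℕ) (x : ℝ) :
    HasSum (fun k : ℕ => (-x) ^ k / k.factorial * momentProd ν n k) (momentLaplace ν n x) :=
  (Summable.of_norm_bounded (Real.summable_pow_div_factorial |x|)
    fun k => norm_momentLaplace_term_le hν n k le_rfl).hasSum

lemma continuous_momentLaplace {ν : ℝ} (hν : ν ∈ Set.Icc (0 : ℝ) 1) (n : ℕ) :
    Continuous (momentLaplace ν n) := by
  refine continuous_iff_continuousAt.2 fun x => ?_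
  refine (continuousOn_tsum (s := Metric.ball 0 (|x| + 1)) (fun k => by fun_prop)
    (Real.summable_pow_div_factorial (|x| + 1)) fun k y hy =>
      norm_momentLaplace_term_le hν n k ?_).continuousAt (Metric.isOpen_ball.mem_nhds (by simp))
  simpa using (mem_ball_zero_iff.1 hy).le

lemma momentLaplace_zero (ν x : ℝ) : momentLaplace ν 0 x = Real.exp (-x) := by
  rw [Real.exp_eq_exp_ℝ, NormedSpace.exp_eq_tsum_div]
  simp [momentLaplace, momentProd]

lemma momentLaplace_succ {ν : ℝ} (hν : ν ∈ Set.Icc (0 : ℝ) 1) (n : ℕ) (x : ℝ) :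
    momentLaplace ν (n + 1) x = ν * momentLaplace ν n x +
      (1 - ν) * ∫ s in (0 : ℝ)..1, (n + 1) * s ^ n * momentLaplace ν n (x * s) := by
  have hsum : HasSum
      (fun k : ℕ => ∫ s in (0 : ℝ)..1,
        (n + 1) * s ^ n * ((-(x * s)) ^ k / k.factorial * momentProd ν n k))
      (∫ s in (0 : ℝ)..1, (n + 1) * s ^ n * momentLaplace ν n (x * s)) := by
    refine intervalIntegral.hasSum_integral_of_dominated_convergence
      (fun k _ => (n + 1) * (|x| ^ k / k.factorial)) (fun k => ?_) (fun k => ?_) ?_ ?_ ?_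
    · exact Continuous.aestronglyMeasurable (by fun_prop)
    · refine .of_forall fun s hs => ?_
      rw [Set.uIoc_of_le zero_le_one] at hs
      obtain ⟨hs0, hs1⟩ := hs
      rw [norm_mul, Real.norm_of_nonneg (by positivity)]
      have h1 : |x * s| ≤ |x| := by
        rw [abs_mul, abs_of_pos hs0]
        exact mul_le_of_le_one_right (abs_nonneg x) hs1
      have h2 : ((n : ℝ) + 1) * s ^ n ≤ n + 1 :=
        mul_le_of_le_one_right (by positivity) (pow_le_one₀ hs0.le hs1)
      exact mul_le_mul h2 (norm_momentLaplace_term_le hν n k h1) (norm_nonneg _) (by positivity)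
    · exact .of_forall fun _ _ => (Real.summable_pow_div_factorial |x|).mul_left _
    · exact intervalIntegrable_const
    · exact .of_forall fun s _ => (hasSum_momentLaplace hν n (x * s)).mul_left _
  have htotal := ((hasSum_momentLaplace hν n x).mul_left ν).add (hsum.mul_left (1 - ν))
  refine (hasSum_momentLaplace hν (n + 1) x).unique (htotal.congr_fun fun k => ?_)
  have hint : ∫ s in (0 : ℝ)..1,
      (n + 1) * s ^ n * ((-(x * s)) ^ k / k.factorial * momentProd ν n k) =
      (n + 1) * ((-x) ^ k / k.factorial * momentProd ν n k) / (n + k + 1) := by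
    have : ∀ s : ℝ, (n + 1) * s ^ n * ((-(x * s)) ^ k / k.factorial * momentProd ν n k) =
        (n + 1) * ((-x) ^ k / k.factorial * momentProd ν n k) * s ^ (n + k) := fun s => by
      rw [← neg_mul, mul_pow, pow_add]
      ring
    simp_rw [this]
    rw [intervalIntegral.integral_const_mul, integral_pow]
    push_cast
    simp
    ring
  rw [hint, momentProd_succ]
  have h1 : (n : ℝ) + 1 + k ≠ 0 := by positivity
  have h2 : (n : ℝ) + k + 1 ≠ 0 := by positivity
  field_simp
  ring

lemma momentLaplace_le_one {ν : ℝ} (hν : ν ∈ Set.Icc (0 : ℝ) 1) (n : ℕ) {x : ℝ} (hx : 0 ≤ x) :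
    momentLaplace ν n x ≤ 1 := by
  induction n generalizing x with
  | zero => simpa [momentLaplace_zero] using hx
  | succ n ih =>
    have hc := continuous_momentLaplace hν n
    have hint : ∫ s in (0 : ℝ)..1, (n + 1) * s ^ n * momentLaplace ν n (x * s) ≤ 1 := by
      calc ∫ s in (0 : ℝ)..1, (n + 1) * s ^ n * momentLaplace ν n (x * s)
          ≤ ∫ s in (0 : ℝ)..1, ((n : ℝ) + 1) * s ^ n := by
            refine intervalIntegral.integral_mono_on zero_le_one
              (Continuous.intervalIntegrable (by fun_prop) _ _)
              (Continuous.intervalIntegrable (by fun_prop) _ _) fun s hs => ?_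
            have := hs.1
            exact mul_le_of_le_one_right (by positivity) (ih (by positivity))
        _ = 1 := by
            rw [intervalIntegral.integral_const_mul, integral_pow]
            have : (n : ℝ) + 1 ≠ 0 := by positivity
            simp [this]
    rw [momentLaplace_succ hν]
    nlinarith [ih hx, hν.1, hν.2]

/-- Jensen's inequality for `momentLaplace`. -/
lemma exp_le_momentLaplace {ν : ℝ} (hν : ν ∈ Set.Icc (0 : ℝ) 1) (n : ℕ) {x : ℝ} (hx : 0 ≤ x) :
    Real.exp (-(x * momentProd ν n 1)) ≤ momentLaplace ν n x := by
  induction n generalizing x with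
  | zero => simp [momentLaplace_zero, momentProd]
  | succ n ih =>
    have hc := continuous_momentLaplace hν n
    have hn : (n : ℝ) + 1 ≠ 0 := by positivity
    have hn' : (n : ℝ) + 2 ≠ 0 := by positivity
    set q := momentProd ν n 1
    set r : ℝ := (n + 1 + ν) / (n + 2) with hr
    set A := Real.exp (-(x * q * r))
    have tangent : ∀ s : ℝ, A * (1 - x * q * (s - r)) ≤ Real.exp (-(x * s * q)) := fun s => by
      have h := Real.add_one_le_exp (-(x * q * (s - r)))
      calc A * (1 - x * q * (s - r)) ≤ A * Real.exp (-(x * q * (s - r))) := by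
            gcongr
            linarith
        _ = _ := by
            rw [← Real.exp_add]
            ring_nf
    have hint : A * (1 - x * q * ((n + 1) / (n + 2) - r)) ≤
        ∫ s in (0 : ℝ)..1, (n + 1) * s ^ n * momentLaplace ν n (x * s) := by
      calc A * (1 - x * q * ((n + 1) / (n + 2) - r))
          = ∫ s in (0 : ℝ)..1, (A * (n + 1) * (1 + x * q * r) * s ^ n -
              A * (n + 1) * (x * q) * s ^ (n + 1)) := by
            rw [intervalIntegral.integral_sub
              (Continuous.intervalIntegrable (by fun_prop) _ _)
              (Continuous.intervalIntegrable (by fun_prop) _ _),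
              intervalIntegral.integral_const_mul, intervalIntegral.integral_const_mul,
              integral_pow, integral_pow]
            have e : ((n + 1 : ℕ) : ℝ) + 1 = n + 2 := by
              push_cast
              ring
            rw [e]
            simp only [one_pow, ne_eq, Nat.add_eq_zero_iff, one_ne_zero, and_false,
              not_false_eq_true, zero_pow, sub_zero]
            generalize r = r'
            field_simp
            ring
        _ ≤ _ := by
            refine intervalIntegral.integral_mono_on zero_le_one
              (Continuous.intervalIntegrable (by fun_prop) _ _)
              (Continuous.intervalIntegrable (by fun_prop) _ _) fun s hs => ?_
            have hs0 := hs.1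
            calc _ = (n + 1) * s ^ n * (A * (1 - x * q * (s - r))) := by ring
              _ ≤ _ := by
                gcongr
                exact (tangent s).trans (ih (by positivity))
    have h1 : A * (1 - x * q * (1 - r)) ≤ momentLaplace ν n x := by
      refine (tangent 1).trans ?_
      simpa using ih hx
    rw [momentLaplace_succ hν, momentProd_succ]
    calc Real.exp (-(x * (q * ((n + 1 + ν * (1 : ℕ)) / (n + 1 + (1 : ℕ)))))) = A := by
          congr 2
          rw [hr]
          push_cast
          ring
      _ = ν * (A * (1 - x * q * (1 - r))) +
          (1 - ν) * (A * (1 - x * q * ((n + 1) / (n + 2) - r))) := by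
          have : ν + (1 - ν) * ((n + 1) / (n + 2)) - r = 0 := by
            rw [hr]
            field_simp
            ring
          linear_combination A * x * q * this
      _ ≤ _ := by
          have := hν.1
          have : 0 ≤ 1 - ν := sub_nonneg.2 hν.2
          gcongr

lemma Gamma_mul_prod_add {x : ℝ} (hx : 0 ≤ x) (n : ℕ) :
    Real.Gamma (x + 1) * ∏ j ∈ Finset.range n, (j + 1 + x) = Real.Gamma (n + x + 1) := by
  induction n with
  | zero => simp
  | succ n ih =>
    rw [Finset.prod_range_succ, ← mul_assoc, ih]
    have h := Real.Gamma_add_one (show (n : ℝ) + x + 1 ≠ 0 by positivity)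
    push_cast
    rw [show (n : ℝ) + 1 + x + 1 = n + x + 1 + 1 by ring, h]
    ring

lemma momentProd_eq_Gamma {ν : ℝ} (hν : 0 ≤ ν) (n k : ℕ) :
    momentProd ν n k = k.factorial / Real.Gamma (ν * k + 1) *
      (Real.Gamma (n + ν * k + 1) / Real.Gamma (n + k + 1)) := by
  have h0 : 0 ≤ ν * k := by positivity
  have h1 := (Real.Gamma_pos_of_pos (show 0 < ν * k + 1 by positivity)).ne'
  have h2 : ∏ j ∈ Finset.range n, ((j : ℝ) + 1 + k) ≠ 0 :=
    Finset.prod_ne_zero_iff.2 fun j _ => by positivity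
  have h3 : (k.factorial : ℝ) ≠ 0 := by positivity
  rw [← Gamma_mul_prod_add h0, ← Gamma_mul_prod_add (Nat.cast_nonneg k),
    Real.Gamma_nat_eq_factorial, momentProd, Finset.prod_div_distrib]
  field_simp

/-- Log-convexity of the Gamma function gives `x ^ d * Γ (x + 1) ≤ Γ (x + d + 1)`. -/
lemma rpow_mul_Gamma_le {x d : ℝ} (hx : 0 < x) (hd : 0 ≤ d) :
    x ^ d * Real.Gamma (x + 1) ≤ Real.Gamma (x + d + 1) := by
  rcases hd.eq_or_lt with rfl | hd
  · simp
  have h := Real.convexOn_log_Gamma.slope_mono_adjacent (x := x) (y := x + 1) (z := x + d + 1)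
    hx (show 0 < x + d + 1 by positivity) (by linarith) (by linarith)
  have hG := Real.Gamma_pos_of_pos hx
  have hG1 := Real.Gamma_pos_of_pos (show 0 < x + 1 by positivity)
  have hGd := Real.Gamma_pos_of_pos (show 0 < x + d + 1 by positivity)
  simp only [Function.comp_apply, add_sub_cancel_left, div_one] at h
  rw [show x + d + 1 - (x + 1) = d by ring, le_div_iff₀ hd] at h
  have hlog : Real.log (Real.Gamma (x + 1)) - Real.log (Real.Gamma x) = Real.log x := by
    rw [Real.Gamma_add_one hx.ne', Real.log_mul hx.ne' hG.ne']
    ring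
  rw [hlog] at h
  rw [← Real.log_le_log_iff (by positivity) hGd, Real.log_mul (by positivity) hG1.ne',
    Real.log_rpow hx]
  linarith

lemma scaled_momentProd_le {ν : ℝ} (hν : ν ∈ Set.Icc (0 : ℝ) 1) {n : ℕ} (hn : 0 < n) (k : ℕ) :
    ((n : ℝ) ^ (1 - ν)) ^ k * momentProd ν n k ≤ k.factorial / Real.Gamma (ν * k + 1) := by
  obtain ⟨h0, h1⟩ := hν
  have hn' : (0 : ℝ) < n := by positivity
  have hk : 0 ≤ ν * k := by positivity
  have hd : 0 ≤ (1 - ν) * k := mul_nonneg (sub_nonneg.2 h1) (by positivity)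
  have hG := Real.Gamma_pos_of_pos (show 0 < ν * k + 1 by positivity)
  have hGn := Real.Gamma_pos_of_pos (show 0 < n + ν * k + 1 by positivity)
  have hGk := Real.Gamma_pos_of_pos (show 0 < (n : ℝ) + k + 1 by positivity)
  rw [momentProd_eq_Gamma h0, ← Real.rpow_mul_natCast hn'.le, mul_left_comm]
  refine mul_le_of_le_one_right (by positivity) ?_
  rw [← mul_div_assoc, div_le_one hGk]
  calc (n : ℝ) ^ ((1 - ν) * k) * Real.Gamma (n + ν * k + 1)
      ≤ (n + ν * k) ^ ((1 - ν) * k) * Real.Gamma (n + ν * k + 1) := by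
        gcongr
        linarith
    _ ≤ Real.Gamma (n + ν * k + (1 - ν) * k + 1) := rpow_mul_Gamma_le (by positivity) hd
    _ = Real.Gamma (n + k + 1) := by ring_nf

lemma tendsto_scaled_momentProd {ν : ℝ} (hν : 0 < ν) (k : ℕ) :
    Tendsto (fun n : ℕ => ((n : ℝ) ^ (1 - ν)) ^ k * momentProd ν n k) atTop
      (nhds (k.factorial / Real.Gamma (ν * k + 1))) := by
  rcases k.eq_zero_or_pos with rfl | hk
  · simp [momentProd, div_self, Nat.cast_add_one_ne_zero]
  have hk' : (0 : ℝ) < k := by positivity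
  have hνk : 0 < ν * k := by positivity
  have hG := Real.Gamma_pos_of_pos hνk
  have hlim := ((Real.GammaSeq_tendsto_Gamma k).div (Real.GammaSeq_tendsto_Gamma (ν * k))
    hG.ne').div_const ν
  have hval : Real.Gamma k / Real.Gamma (ν * k) / ν =
      k.factorial / Real.Gamma (ν * k + 1) := by
    rw [← Real.Gamma_nat_eq_factorial, Real.Gamma_add_one hνk.ne', Real.Gamma_add_one hk'.ne']
    field_simp
  rw [hval] at hlim
  refine hlim.congr' ?_
  filter_upwards [eventually_gt_atTop 0] with n hn
  have hn' : (0 : ℝ) < n := by positivity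
  have hprod : ∀ x : ℝ, ∏ j ∈ Finset.range (n + 1), (x + j) =
      (∏ j ∈ Finset.range n, (j + 1 + x)) * x := fun x => by
    rw [Finset.prod_range_succ']
    congr 1
    · refine Finset.prod_congr rfl fun j _ => ?_
      push_cast
      ring
    · simp
  have h1 : ∏ j ∈ Finset.range n, ((j : ℝ) + 1 + k) ≠ 0 :=
    Finset.prod_ne_zero_iff.2 fun j _ => by positivity
  have h2 : ∏ j ∈ Finset.range n, ((j : ℝ) + 1 + ν * k) ≠ 0 :=
    Finset.prod_ne_zero_iff.2 fun j _ => by positivity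
  have h3 : (n.factorial : ℝ) ≠ 0 := by positivity
  have h4 : (n : ℝ) ^ (ν * k) ≠ 0 := by positivity
  simp only [Pi.div_apply, Real.GammaSeq]
  rw [hprod, hprod, momentProd, Finset.prod_div_distrib, ← Real.rpow_mul_natCast hn'.le,
    show (1 - ν) * k = k - ν * k by ring, Real.rpow_sub hn']
  field_simp

lemma tendsto_momentLaplace {ν : ℝ} (hν : ν ∈ Set.Ioo (0 : ℝ) 1) (x : ℝ) :
    Tendsto (fun n : ℕ => momentLaplace ν n (x * (n : ℝ) ^ (1 - ν))) atTop
      (nhds (mittagLeffler ν (-x))) := by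
  have hterm : ∀ n k : ℕ, (-(x * (n : ℝ) ^ (1 - ν))) ^ k / k.factorial * momentProd ν n k =
      (-x) ^ k / k.factorial * (((n : ℝ) ^ (1 - ν)) ^ k * momentProd ν n k) := fun n k => by
    rw [← neg_mul, mul_pow]
    ring
  have hcancel : ∀ (y : ℝ) (k : ℕ),
      y ^ k / k.factorial * (k.factorial / Real.Gamma (ν * k + 1)) =
        y ^ k / Real.Gamma (ν * k + 1) := fun y k =>
    div_mul_div_cancel₀ (by positivity)
  refine tendsto_tsum_of_dominated_convergence
    (summable_mittagLeffler hν.1 (abs_nonneg x)) (fun k => ?_) ?_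
  · simp_rw [hterm]
    rw [← hcancel]
    exact (tendsto_scaled_momentProd hν.1 k).const_mul _
  · filter_upwards [eventually_gt_atTop 0] with n hn k
    have hP := momentProd_nonneg hν.1.le n k
    rw [hterm, norm_mul, norm_div, norm_pow, norm_neg, Real.norm_natCast, Real.norm_eq_abs,
      Real.norm_of_nonneg (by positivity), ← hcancel]
    gcongr
    exact scaled_momentProd_le ⟨hν.1.le, hν.2.le⟩ hn k

lemma mittagLeffler_neg_le_one {ν : ℝ} (hν : ν ∈ Set.Ioo (0 : ℝ) 1) {x : ℝ} (hx : 0 ≤ x) :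
    mittagLeffler ν (-x) ≤ 1 :=
  le_of_tendsto' (tendsto_momentLaplace hν x) fun n =>
    momentLaplace_le_one ⟨hν.1.le, hν.2.le⟩ n (by positivity)

lemma exp_le_mittagLeffler_neg {ν : ℝ} (hν : ν ∈ Set.Ioo (0 : ℝ) 1) {x : ℝ} (hx : 0 ≤ x) :
    Real.exp (-(x * (1 / Real.Gamma (ν + 1)))) ≤ mittagLeffler ν (-x) := by
  have h := ((tendsto_scaled_momentProd hν.1 1).const_mul x).neg.rexp
  simp only [pow_one, Nat.factorial_one, Nat.cast_one, mul_one] at h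
  refine le_of_tendsto_of_tendsto' h (tendsto_momentLaplace hν x) fun n => ?_
  rw [← mul_assoc]
  exact exp_le_momentLaplace ⟨hν.1.le, hν.2.le⟩ n (by positivity)

lemma tendsto_log_mittagLeffler_neg {ν : ℝ} (hν : ν ∈ Set.Ioo (0 : ℝ) 1) {b : ℝ} (hb : 0 ≤ b) :
    Tendsto (fun t : ℝ => (1 / t) * Real.log (mittagLeffler ν (-(b * t ^ ν)))) atTop (nhds 0) := by
  set C := b * (1 / Real.Gamma (ν + 1))
  have hlow : Tendsto (fun t : ℝ => -(C * t ^ (-(1 - ν)))) atTop (nhds 0) := by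
    simpa using ((tendsto_rpow_neg_atTop (sub_pos.2 hν.2)).const_mul C).neg
  refine tendsto_of_tendsto_of_tendsto_of_le_of_le' hlow tendsto_const_nhds ?_ ?_
  · filter_upwards [eventually_gt_atTop 0] with t ht
    have h := Real.log_le_log (Real.exp_pos _)
      (exp_le_mittagLeffler_neg hν (show 0 ≤ b * t ^ ν by positivity))
    rw [Real.log_exp] at h
    calc -(C * t ^ (-(1 - ν))) = 1 / t * -(b * t ^ ν * (1 / Real.Gamma (ν + 1))) := by
          rw [neg_sub, Real.rpow_sub_one ht.ne']
          ring
      _ ≤ _ := by gcongr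
  · filter_upwards [eventually_gt_atTop 0] with t ht
    have hx : 0 ≤ b * t ^ ν := by positivity
    exact mul_nonpos_of_nonneg_of_nonpos (by positivity) <| Real.log_nonpos
      ((Real.exp_pos _).le.trans (exp_le_mittagLeffler_neg hν hx)) (mittagLeffler_neg_le_one hν hx)

lemma tendsto_log_mittagLeffler_rpow {ν : ℝ} (hν : ν ∈ Set.Ioo (0 : ℝ) 1) :
    Tendsto (fun T : ℝ => (1 / T) * Real.log (mittagLeffler ν (T ^ ν))) atTop (nhds 1) := by
  refine tendsto_order.2 ⟨fun a ha => ?_, fun a ha => ?_⟩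
  · obtain ⟨θ, hθ, hθ1⟩ := exists_between (max_lt ha zero_lt_one)
    obtain ⟨haθ, hθ0⟩ := max_lt_iff.1 hθ
    have hlim : Tendsto (fun T : ℝ => (Real.log (1 - θ) - 1) / T + θ) atTop (nhds (0 + θ)) :=
      (tendsto_const_nhds.div_atTop tendsto_id).add_const θ
    rw [zero_add] at hlim
    filter_upwards [hlim.eventually (lt_mem_nhds haθ), eventually_gt_atTop 0] with T hT hT0
    have hθ' : 0 < 1 - θ := sub_pos.2 hθ1
    have h := Real.log_le_log (by positivity) (le_mittagLeffler_rpow hν hT0 ⟨hθ0, hθ1⟩)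
    rw [Real.log_mul hθ'.ne' (Real.exp_pos _).ne', Real.log_exp] at h
    calc a < (Real.log (1 - θ) - 1) / T + θ := hT
      _ = 1 / T * (Real.log (1 - θ) + (θ * T - 1)) := by
          field_simp
          ring
      _ ≤ _ := by gcongr
  · obtain ⟨ρ, hρ, hρa⟩ := exists_between ha
    have hρ0 : 0 < ρ := zero_lt_one.trans hρ
    set K : ℝ := (1 - ρ⁻¹ ^ ν)⁻¹
    have hK : 0 < K := inv_pos.2 <| sub_pos.2 <|
      Real.rpow_lt_one (by positivity) (inv_lt_one_of_one_lt₀ hρ) hν.1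
    have hlim : Tendsto (fun T : ℝ => Real.log K / T + ρ) atTop (nhds (0 + ρ)) :=
      (tendsto_const_nhds.div_atTop tendsto_id).add_const ρ
    rw [zero_add] at hlim
    filter_upwards [hlim.eventually (gt_mem_nhds hρa), eventually_gt_atTop 0] with T hT hT0
    have hpos : 0 < mittagLeffler ν (T ^ ν) :=
      lt_of_lt_of_le (by positivity)
        (le_mittagLeffler_rpow hν hT0 (θ := 1 / 2) ⟨by norm_num, by norm_num⟩)
    have h := Real.log_le_log hpos
      (mittagLeffler_rpow_le hν.1 hT0.le (show T < ρ * T from lt_mul_of_one_lt_left hT0 hρ))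
    rw [show T / (ρ * T) = ρ⁻¹ by field_simp, Real.log_mul (Real.exp_pos _).ne' hK.ne',
      Real.log_exp] at h
    calc 1 / T * Real.log (mittagLeffler ν (T ^ ν)) ≤ 1 / T * (ρ * T + Real.log K) := by gcongr
      _ = Real.log K / T + ρ := by
          field_simp
          ring
      _ < a := hT

theorem mittagLeffler_log_asymptotics (ν : ℝ) (hν : ν ∈ Set.Ioo (0 : ℝ) 1) (c : ℝ) :
    Tendsto (fun t : ℝ => (1 / t) * Real.log (mittagLeffler ν (c * t ^ ν)))
      atTop (nhds ((max c 0) ^ (1 / ν))) := by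
  rcases le_or_gt c 0 with hc | hc
  · rw [max_eq_right hc, Real.zero_rpow (one_div_ne_zero hν.1.ne')]
    simpa using tendsto_log_mittagLeffler_neg hν (neg_nonneg.2 hc)
  · rw [max_eq_left hc.le]
    set C := c ^ (1 / ν) with hC
    have hC0 : 0 < C := by positivity
    have hCν : C ^ ν = c := by
      rw [hC, one_div, Real.rpow_inv_rpow hc.le hν.1.ne']
    have h := ((tendsto_log_mittagLeffler_rpow hν).comp
      (tendsto_id.const_mul_atTop hC0)).const_mul C
    rw [mul_one] at h
    refine h.congr' ?_
    filter_upwards [eventually_gt_atTop 0] with t ht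
    simp only [Function.comp_apply, id_eq]
    rw [Real.mul_rpow hC0.le ht.le, hCν]
    field_simp
end

section
/- Let ν ∈ (0,1) and let m be a nonzero real number. Define Λ(θ) := (mθ)^{1/ν} if mθ ≥ 0 and Λ(θ) := 0 if mθ < 0. Then for every real x with x/m ≥ 0, the supremum over θ ∈ ℝ of θx − Λ(θ) is attained at θ_x = (1/m)·(νx/m)^{ν/(1−ν)} and equals (ν^{ν/(1−ν)} − ν^{1/(1−ν)}) · (x/m)^{1/(1−ν)}. -/
noncomputable def LambdaMD (ν m θ : ℝ) : ℝ := if 0 ≤ m * θ then (m * θ) ^ (1 / ν) else 0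

/-- If `ν ∈ (0, 1)`, then `1 / ν` and `1 / (1 - ν)` are Hölder conjugate. -/
lemma holderConjugate_one_div_one_div_one_sub {ν : ℝ} (hν : ν ∈ Set.Ioo (0 : ℝ) 1) :
    (1 / ν).HolderConjugate (1 / (1 - ν)) := by
  rw [Real.holderConjugate_iff]
  exact ⟨one_lt_one_div hν.1 hν.2, by simp⟩

lemma rpow_one_div_one_sub {ν a : ℝ} (hν : ν ∈ Set.Ioo (0 : ℝ) 1) (ha : 0 ≤ a) :
    a ^ (1 / (1 - ν)) = a ^ (ν / (1 - ν)) * a := by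
  have h1 : 0 < 1 - ν := sub_pos.2 hν.2
  have hexp : 1 / (1 - ν) = ν / (1 - ν) + 1 := by field_simp; ring
  rw [hexp, Real.rpow_add_one' ha (by rw [← hexp]; positivity)]

lemma mul_sub_rpow_one_div_eq {ν y : ℝ} (hν : ν ∈ Set.Ioo (0 : ℝ) 1) (hy : 0 ≤ y) :
    (ν * y) ^ (ν / (1 - ν)) * y - ((ν * y) ^ (ν / (1 - ν))) ^ (1 / ν) =
      (ν ^ (ν / (1 - ν)) - ν ^ (1 / (1 - ν))) * y ^ (1 / (1 - ν)) := by
  have h0 : ν ≠ 0 := hν.1.ne'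
  have hexp : ν / (1 - ν) * (1 / ν) = 1 / (1 - ν) := by field_simp
  rw [← Real.rpow_mul (mul_nonneg hν.1.le hy), hexp, Real.mul_rpow hν.1.le hy,
    Real.mul_rpow hν.1.le hy, rpow_one_div_one_sub hν hy]
  ring

lemma mul_sub_rpow_one_div_le {ν u y : ℝ} (hν : ν ∈ Set.Ioo (0 : ℝ) 1) (hu : 0 ≤ u)
    (hy : 0 ≤ y) :
    u * y - u ^ (1 / ν) ≤
      (ν ^ (ν / (1 - ν)) - ν ^ (1 / (1 - ν))) * y ^ (1 / (1 - ν)) := by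
  have young := Real.young_inequality_of_nonneg hu (mul_nonneg hν.1.le hy)
    (holderConjugate_one_div_one_div_one_sub hν)
  rw [Real.mul_rpow hν.1.le hy, rpow_one_div_one_sub hν hν.1.le, div_div_eq_mul_div,
    div_div_eq_mul_div, div_one, div_one] at young
  rw [rpow_one_div_one_sub hν hν.1.le]
  refine le_of_mul_le_mul_left ?_ hν.1
  linarith

theorem legendre_transform_noncentered (ν : ℝ) (hν : ν ∈ Set.Ioo (0 : ℝ) 1)
    (m : ℝ) (hm : m ≠ 0) (x : ℝ) (hx : 0 ≤ x / m) :
    (fun θ : ℝ => θ * x - LambdaMD ν m θ) ((1 / m) * (ν * x / m) ^ (ν / (1 - ν))) =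
      (ν ^ (ν / (1 - ν)) - ν ^ (1 / (1 - ν))) * (x / m) ^ (1 / (1 - ν)) ∧
    ∀ θ : ℝ, θ * x - LambdaMD ν m θ ≤
      (ν ^ (ν / (1 - ν)) - ν ^ (1 / (1 - ν))) * (x / m) ^ (1 / (1 - ν)) := by
  have hprod (θ : ℝ) : θ * x = m * θ * (x / m) := by field_simp
  constructor
  · have hcancel (w : ℝ) : m * (1 / m * w) = w := by field_simp
    have hnonneg : 0 ≤ (ν * (x / m)) ^ (ν / (1 - ν)) :=
      Real.rpow_nonneg (mul_nonneg hν.1.le hx) _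
    rw [mul_div_assoc ν x m]
    beta_reduce
    rw [LambdaMD, hprod, hcancel, if_pos hnonneg]
    exact mul_sub_rpow_one_div_eq hν hx
  · intro θ
    rw [LambdaMD, hprod]
    split_ifs with h
    · exact mul_sub_rpow_one_div_le hν h hx
    · have h0 := mul_sub_rpow_one_div_le hν le_rfl hx
      rw [Real.zero_rpow (one_div_ne_zero hν.1.ne')] at h0
      linarith [mul_nonpos_of_nonpos_of_nonneg (not_le.1 h).le hx]
end

section
/- Let ν ∈ (0,1) and m₁, m₂ > 0 with m₁ ≠ m₂, and set c_ν := ν^{ν/(1−ν)} − ν^{1/(1−ν)} and m := m₁ − m₂. Define I : ℝ → ℝ ∪ {+∞} (extended reals) by I(x) := c_ν·(x/m)^{1/(1−ν)} if x/m ≥ 0 and I(x) := +∞ if x/m < 0, and define J : ℝ → ℝ by J(x) := c_ν·(x/m₁)^{1/(1−ν)} for x ≥ 0 and J(x) := c_ν·(−x/m₂)^{1/(1−ν)} for x < 0. Then I(0) = J(0) = 0, and for every x ≠ 0 one has 0 < J(x) and J(x) < I(x) (as extended reals). -/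
theorem rate_function_comparison_MD (ν : ℝ) (hν : ν ∈ Set.Ioo (0 : ℝ) 1)
    (m₁ m₂ : ℝ) (hm₁ : 0 < m₁) (hm₂ : 0 < m₂) (hm : m₁ ≠ m₂)
    (cν : ℝ) (hcν : cν = ν ^ (ν / (1 - ν)) - ν ^ (1 / (1 - ν)))
    (m : ℝ) (hmdef : m = m₁ - m₂)
    (I : ℝ → EReal)
    (hI : ∀ x : ℝ, I x = if 0 ≤ x / m then ((cν * (x / m) ^ (1 / (1 - ν)) : ℝ) : EReal) else ⊤)
    (J : ℝ → ℝ)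
    (hJ : ∀ x : ℝ, J x = if 0 ≤ x then cν * (x / m₁) ^ (1 / (1 - ν))
                         else cν * (-x / m₂) ^ (1 / (1 - ν))) :
    I 0 = 0 ∧ J 0 = 0 ∧ ∀ x : ℝ, x ≠ 0 → 0 < J x ∧ (J x : EReal) < I x := by
  obtain ⟨h0, h1⟩ := hν
  have hs : 0 < 1 - ν := sub_pos.2 h1
  have hp : 0 < 1 / (1 - ν) := one_div_pos.2 hs
  have hc : 0 < cν := by
    rw [hcν, sub_pos]
    exact Real.rpow_lt_rpow_of_exponent_gt h0 h1 (by gcongr)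
  have hz : (0 : ℝ) ^ (1 / (1 - ν)) = 0 := Real.zero_rpow hp.ne'
  have hm0 : m ≠ 0 := hmdef ▸ sub_ne_zero.2 hm
  refine ⟨by rw [hI, zero_div, if_pos le_rfl, hz, mul_zero, EReal.coe_zero],
    by rw [hJ, if_pos le_rfl, zero_div, hz, mul_zero], fun x hx => ?_⟩
  obtain ⟨y, hy, hJy, hlt⟩ : ∃ y : ℝ, 0 < y ∧ J x = cν * y ^ (1 / (1 - ν)) ∧
      (0 ≤ x / m → y < x / m) := by
    rcases hx.lt_or_gt with hx | hx
    · refine ⟨-x / m₂, div_pos (neg_pos.2 hx) hm₂, by rw [hJ, if_neg hx.not_ge], fun h => ?_⟩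
      rcases hm0.lt_or_gt with h' | h'
      · rw [← neg_div_neg_eq x m]
        exact div_lt_div_of_pos_left (neg_pos.2 hx) (neg_pos.2 h') (by linarith)
      · exact absurd h (div_neg_of_neg_of_pos hx h').not_ge
    · refine ⟨x / m₁, div_pos hx hm₁, by rw [hJ, if_pos hx.le], fun h => ?_⟩
      rcases hm0.lt_or_gt with h' | h'
      · exact absurd h (div_neg_of_pos_of_neg hx h').not_ge
      · exact div_lt_div_of_pos_left hx h' (by linarith)
  rw [hJy, hI]
  refine ⟨mul_pos hc (Real.rpow_pos_of_pos hy _), ?_⟩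
  split_ifs with h
  · exact EReal.coe_lt_coe_iff.2
      (mul_lt_mul_of_pos_left (Real.rpow_lt_rpow hy.le (hlt h) hp) hc)
  · exact EReal.coe_lt_top _
end

section
/- Let ν ∈ (0,1), m_* > 0 and q > 0. Define J(x) := (ν^{ν/(1−ν)} − ν^{1/(1−ν)})·(|x|/m_*)^{1/(1−ν)} and I(x) := ((ν/2)^{ν/(2−ν)} − (ν/2)^{2/(2−ν)})·(2x²/q)^{1/(2−ν)} for x ∈ ℝ. Then there exists δ_ν > 0 such that for every real x: if 0 < |x| < δ_ν then I(x) > J(x) > 0; if |x| > δ_ν then J(x) > I(x) > 0; and if |x| = δ_ν then I(x) = J(x) > 0. -/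
/-- Two positive multiples of powers with distinct exponents cross exactly once on `(0, ∞)`. -/
theorem exists_crossing_mul_rpow {A B a b : ℝ} (hA : 0 < A) (hB : 0 < B) (hab : b < a) :
    ∃ δ : ℝ, 0 < δ ∧ ∀ y : ℝ, 0 < y →
      (y < δ → A * y ^ a < B * y ^ b) ∧ (δ < y → B * y ^ b < A * y ^ a) ∧
      (y = δ → B * y ^ b = A * y ^ a) := by
  have hd : 0 < a - b := sub_pos.2 hab
  have hδ : 0 < (B / A) ^ (a - b)⁻¹ := by positivity
  have hδB : A * ((B / A) ^ (a - b)⁻¹) ^ (a - b) = B := by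
    rw [Real.rpow_inv_rpow (by positivity) hd.ne']
    field_simp
  refine ⟨(B / A) ^ (a - b)⁻¹, hδ, fun y hy => ?_⟩
  have hyb : 0 < y ^ b := Real.rpow_pos_of_pos hy b
  have hsplit : A * y ^ a = A * y ^ (a - b) * y ^ b := by
    rw [mul_assoc, ← Real.rpow_add hy, sub_add_cancel]
  rw [hsplit]
  refine ⟨fun h => ?_, fun h => ?_, fun h => ?_⟩
  · refine mul_lt_mul_of_pos_right ?_ hyb
    exact (mul_lt_mul_of_pos_left (Real.rpow_lt_rpow hy.le h hd) hA).trans_eq hδB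
  · refine mul_lt_mul_of_pos_right ?_ hyb
    exact hδB.symm.trans_lt (mul_lt_mul_of_pos_left (Real.rpow_lt_rpow hδ.le h hd) hA)
  · rw [h, hδB]

theorem rate_function_comparison_MD_equal_means (ν : ℝ) (hν : ν ∈ Set.Ioo (0 : ℝ) 1)
    (mstar q : ℝ) (hmstar : 0 < mstar) (hq : 0 < q)
    (J : ℝ → ℝ)
    (hJ : ∀ x : ℝ, J x = (ν ^ (ν / (1 - ν)) - ν ^ (1 / (1 - ν))) * (|x| / mstar) ^ (1 / (1 - ν)))
    (I : ℝ → ℝ)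
    (hI : ∀ x : ℝ, I x = ((ν / 2) ^ (ν / (2 - ν)) - (ν / 2) ^ (2 / (2 - ν))) *
                          (2 * x ^ 2 / q) ^ (1 / (2 - ν))) :
    ∃ δ : ℝ, 0 < δ ∧ ∀ x : ℝ,
      (0 < |x| → |x| < δ → I x > J x ∧ J x > 0) ∧
      (|x| > δ → J x > I x ∧ I x > 0) ∧
      (|x| = δ → I x = J x ∧ J x > 0) := by
  obtain ⟨h0, h1⟩ := hν
  have h1ν : 0 < 1 - ν := by linarith
  have h2ν : 0 < 2 - ν := by linarith
  have hcJ : 0 < ν ^ (ν / (1 - ν)) - ν ^ (1 / (1 - ν)) :=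
    sub_pos.2 (Real.rpow_lt_rpow_of_exponent_gt h0 h1 (by gcongr))
  have hcI : 0 < (ν / 2) ^ (ν / (2 - ν)) - (ν / 2) ^ (2 / (2 - ν)) :=
    sub_pos.2 (Real.rpow_lt_rpow_of_exponent_gt (by linarith) (by linarith)
      (div_lt_div_of_pos_right (by linarith) h2ν))
  set cJ := ν ^ (ν / (1 - ν)) - ν ^ (1 / (1 - ν))
  set cI := (ν / 2) ^ (ν / (2 - ν)) - (ν / 2) ^ (2 / (2 - ν))
  have hJ' (x : ℝ) : J x = cJ / mstar ^ (1 / (1 - ν)) * |x| ^ (1 / (1 - ν)) := by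
    rw [hJ, Real.div_rpow (abs_nonneg x) hmstar.le]
    ring
  have hI' (x : ℝ) : I x = cI * (2 / q) ^ (1 / (2 - ν)) * |x| ^ (2 * (1 / (2 - ν))) := by
    rw [hI, Real.rpow_mul (abs_nonneg x), Real.rpow_two, sq_abs, mul_assoc,
      ← Real.mul_rpow (by positivity) (by positivity), div_mul_eq_mul_div]
  have hexp : 2 * (1 / (2 - ν)) < 1 / (1 - ν) := by
    rw [mul_one_div, div_lt_div_iff₀ h2ν h1ν]
    linarith
  have hA : 0 < cJ / mstar ^ (1 / (1 - ν)) := by positivity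
  have hB : 0 < cI * (2 / q) ^ (1 / (2 - ν)) := by positivity
  obtain ⟨δ, hδ, hcross⟩ := exists_crossing_mul_rpow hA hB hexp
  refine ⟨δ, hδ, fun x => ?_⟩
  rw [hJ', hI']
  refine ⟨fun hx h => ⟨(hcross _ hx).1 h, by positivity⟩, fun h => ?_, fun h => ?_⟩
  · have hx : 0 < |x| := hδ.trans h
    exact ⟨(hcross _ hx).2.1 h, by positivity⟩
  · have hx : 0 < |x| := h ▸ hδ
    exact ⟨(hcross _ hx).2.2 h, by positivity⟩
end

section
/- Fix β ∈ (0,1), r₁, r₂ > 0 and 0 < η < ν < 1. With the rate functions I_ν, J_ν, I_η, J_η of the tempered stable example, there exists δ > 0 such that for every real x with 0 < |x| < δ one has I_η(x) > I_ν(x) > 0 and J_η(x) > J_ν(x) > 0. -/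
/-- Lévy exponent of a tempered stable subordinator with parameters `β` and `r`
(for arguments `θ ≤ r`). -/
noncomputable def kappaTS (β r θ : ℝ) : ℝ := r ^ β - (r - θ) ^ β

/-- The function `Ψ_ν` of the tempered stable example (for `θ ∈ [-r₂, r₁]`). -/
noncomputable def PsiTS (β r₁ r₂ ν θ : ℝ) : ℝ :=
  if 0 ≤ θ then (kappaTS β r₁ θ) ^ (1 / ν) else (kappaTS β r₂ (-θ)) ^ (1 / ν)

/-- The function `Λ_ν` of the tempered stable example (for `θ ∈ [-r₂, r₁]`). -/
noncomputable def LamTS (β r₁ r₂ ν θ : ℝ) : ℝ :=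
  (max (kappaTS β r₁ θ + kappaTS β r₂ (-θ)) 0) ^ (1 / ν)

/-- Rate function `J_ν` of the tempered stable example. -/
noncomputable def JrateTS (β r₁ r₂ ν x : ℝ) : ℝ :=
  ⨆ θ : Set.Icc (-r₂) r₁, ((θ : ℝ) * x - PsiTS β r₁ r₂ ν θ)

/-- Rate function `I_ν` of the tempered stable example. -/
noncomputable def IrateTS (β r₁ r₂ ν x : ℝ) : ℝ :=
  ⨆ θ : Set.Icc (-r₂) r₁, ((θ : ℝ) * x - LamTS β r₁ r₂ ν θ)

open Set in
/-- A convex nonnegative function raised to a power `p > 1` grows more slowly than any linear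
function near its zeros. -/
theorem ConvexOn.exists_mul_sub_rpow_gt {s : Set ℝ} {G : ℝ → ℝ} (hG : ConvexOn ℝ s G)
    (h0 : ∀ θ ∈ s, 0 ≤ G θ) {p : ℝ} (hp : 1 < p) {x u c : ℝ} (hu : u ∈ s) (hGu : G u = 0)
    (hc : c ∈ s) (hcx : 0 < (c - u) * x) : ∃ θ ∈ s, u * x < θ * x - G θ ^ p := by
  have hcont : Filter.Tendsto (fun t : ℝ => t ^ (p - 1) * G c ^ p) (nhdsWithin 0 (Ioi 0))
      (nhds 0) := by
    have h : Continuous (fun t : ℝ => t ^ (p - 1) * G c ^ p) :=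
      (Real.continuous_rpow_const (by linarith)).mul continuous_const
    have h' := (h.tendsto 0).mono_left (nhdsWithin_le_nhds (s := Ioi (0 : ℝ)))
    simpa [Real.zero_rpow (by linarith : p - 1 ≠ 0)] using h'
  obtain ⟨t, ht, ht0, ht1⟩ := ((hcont.eventually_lt_const hcx).and
    (Ioo_mem_nhdsGT (zero_lt_one' ℝ))).exists
  have hmem : (1 - t) * u + t * c ∈ s :=
    hG.1 hu hc (by linarith) ht0.le (by ring)
  refine ⟨_, hmem, ?_⟩
  have hle : G ((1 - t) * u + t * c) ≤ t * G c := by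
    have := hG.2 hu hc (by linarith : 0 ≤ 1 - t) ht0.le (by ring)
    simpa [hGu] using this
  have hpow : G ((1 - t) * u + t * c) ^ p ≤ t * (t ^ (p - 1) * G c ^ p) := by
    refine (Real.rpow_le_rpow (h0 _ hmem) hle (by linarith)).trans_eq ?_
    rw [Real.mul_rpow ht0.le (h0 c hc), ← mul_assoc]
    congr 1
    rw [Real.rpow_sub_one ht0.ne']
    field_simp
  have := mul_lt_mul_of_pos_left ht ht0
  nlinarith

open Set in
/-- The Legendre transform of a power `G ^ p` of a convex function, near the origin, is positive
and strictly increasing in the exponent. -/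
theorem iSup_mul_sub_rpow_lt {a b : ℝ} (ha : a < 0) (hb : 0 < b) {G : ℝ → ℝ}
    (hconv : ConvexOn ℝ (Icc a b) G) (hcont : ContinuousOn G (Icc a b))
    (h0 : ∀ θ ∈ Icc a b, 0 ≤ G θ) (hG0 : G 0 = 0) (hGa : 0 < G a) (hGb : 0 < G b)
    {p q : ℝ} (hp : 1 < p) (hpq : p < q) {x : ℝ} (hx : x ≠ 0) (hx1 : (b - a) * |x| < 1) :
    (⨆ θ : Icc a b, ((θ : ℝ) * x - G θ ^ p)) < (⨆ θ : Icc a b, ((θ : ℝ) * x - G θ ^ q)) ∧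
      0 < ⨆ θ : Icc a b, ((θ : ℝ) * x - G θ ^ p) := by
  have hmem0 : (0 : ℝ) ∈ Icc a b := ⟨ha.le, hb.le⟩
  have escape : ∀ u ∈ Icc a b, G u = 0 → ∃ θ ∈ Icc a b, u * x < θ * x - G θ ^ p := by
    intro u hu hGu
    rcases hx.lt_or_gt with hx | hx
    · have : u ≠ a := by rintro rfl; linarith
      exact hconv.exists_mul_sub_rpow_gt h0 hp hu hGu (left_mem_Icc.2 (by linarith))
        (mul_pos_of_neg_of_neg (sub_neg.2 (hu.1.lt_of_ne' this)) hx)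
    · have : u ≠ b := by rintro rfl; linarith
      exact hconv.exists_mul_sub_rpow_gt h0 hp hu hGu (right_mem_Icc.2 (by linarith))
        (mul_pos (sub_pos.2 (hu.2.lt_of_ne this)) hx)
  have cont : ∀ e : ℝ, 0 ≤ e → ContinuousOn (fun θ => θ * x - G θ ^ e) (Icc a b) := fun e he =>
    (continuousOn_id.mul continuousOn_const).sub (hcont.rpow_const fun _ _ => Or.inr he)
  have bdd : ∀ e : ℝ, 0 ≤ e →
      BddAbove (range fun θ : Icc a b => ((θ : ℝ) * x - G θ ^ e)) := fun e he => by
    have := isCompact_Icc.bddAbove_image (cont e he)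
    rwa [image_eq_range] at this
  obtain ⟨u, hu, hmax⟩ := isCompact_Icc.exists_isMaxOn ⟨0, hmem0⟩ (cont p (by linarith))
  have : Nonempty (Icc a b) := ⟨⟨0, hmem0⟩⟩
  have hsup : (⨆ θ : Icc a b, ((θ : ℝ) * x - G θ ^ p)) = u * x - G u ^ p :=
    le_antisymm (ciSup_le fun θ => hmax θ.2) (le_ciSup (bdd p (by linarith)) ⟨u, hu⟩)
  have hpos : 0 < u * x - G u ^ p := by
    obtain ⟨θ, hθ, h⟩ := escape 0 hmem0 hG0
    have := hmax hθ
    simp only [mem_ofPred_eq] at this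
    linarith
  rw [hsup]
  refine ⟨lt_of_lt_of_le ?_ (le_ciSup (bdd q (by linarith)) ⟨u, hu⟩), hpos⟩
  have hGu : 0 < G u := by
    refine (h0 u hu).lt_of_ne' fun h => ?_
    obtain ⟨θ, hθ, hlt⟩ := escape u hu h
    have := hmax hθ
    simp only [mem_ofPred_eq, h, Real.zero_rpow (by linarith : p ≠ 0)] at this
    linarith
  have hGu1 : G u < 1 := by
    by_contra! h
    have h1 := Real.one_le_rpow h (by linarith : 0 ≤ p)
    have h2 : u * x ≤ (b - a) * |x| := by
      refine (le_abs_self _).trans ?_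
      rw [abs_mul]
      gcongr
      exact abs_le.2 ⟨by linarith [hu.1], by linarith [hu.2]⟩
    linarith
  have := Real.rpow_lt_rpow_of_exponent_gt hGu hGu1 hpq
  simp only
  linarith

theorem Real.add_rpow_lt_rpow_add_rpow {a b β : ℝ} (ha : 0 < a) (hb : 0 < b) (hβ : β < 1) :
    (a + b) ^ β < a ^ β + b ^ β := by
  have hs : 0 < a + b := add_pos ha hb
  have key : ∀ c : ℝ, 0 < c → c < a + b → c / (a + b) * (a + b) ^ β < c ^ β := by
    intro c hc hcs
    have h := Real.rpow_lt_rpow_of_exponent_gt (div_pos hc hs) ((div_lt_one hs).2 hcs) hβ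
    rwa [Real.rpow_one, Real.div_rpow hc.le hs.le, lt_div_iff₀ (Real.rpow_pos_of_pos hs β)] at h
  have h1 := key a ha (by linarith)
  have h2 := key b hb (by linarith)
  have h3 : a / (a + b) * (a + b) ^ β + b / (a + b) * (a + b) ^ β = (a + b) ^ β := by
    field_simp
  linarith

theorem convexOn_kappaTS {β : ℝ} (h0 : 0 ≤ β) (h1 : β ≤ 1) (r : ℝ) :
    ConvexOn ℝ (Set.Iic r) (kappaTS β r) := by
  refine ⟨convex_Iic r, fun u hu v hv s t hs ht hst => ?_⟩
  have h := (Real.concaveOn_rpow h0 h1).2 (Set.mem_Ici.2 (sub_nonneg.2 hu))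
    (Set.mem_Ici.2 (sub_nonneg.2 hv)) hs ht hst
  have e : s * (r - u) + t * (r - v) = r - (s * u + t * v) := by linear_combination r * hst
  simp only [smul_eq_mul, kappaTS] at h ⊢
  rw [e] at h
  linear_combination h - r ^ β * hst

theorem convexOn_kappaTS_neg {β : ℝ} (h0 : 0 ≤ β) (h1 : β ≤ 1) (r : ℝ) :
    ConvexOn ℝ (Set.Ici (-r)) (fun θ => kappaTS β r (-θ)) := by
  refine ⟨convex_Ici _, fun u hu v hv s t hs ht hst => ?_⟩
  have h := (convexOn_kappaTS h0 h1 r).2 (Set.mem_Iic.2 (neg_le.1 hu))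
    (Set.mem_Iic.2 (neg_le.1 hv)) hs ht hst
  convert h using 2
  simp only [smul_eq_mul]
  ring

theorem continuous_kappaTS {β : ℝ} (h0 : 0 ≤ β) (r : ℝ) : Continuous (kappaTS β r) :=
  continuous_const.sub ((continuous_const.sub continuous_id).rpow_const fun _ => Or.inr h0)

@[simp] theorem kappaTS_zero (β r : ℝ) : kappaTS β r 0 = 0 := by simp [kappaTS]

theorem kappaTS_nonneg {β r θ : ℝ} (hβ : 0 ≤ β) (h0 : 0 ≤ θ) (hr : θ ≤ r) :
    0 ≤ kappaTS β r θ :=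
  sub_nonneg.2 (Real.rpow_le_rpow (by linarith) (by linarith) hβ)

theorem kappaTS_nonpos {β r θ : ℝ} (hβ : 0 ≤ β) (hr : 0 ≤ r) (h0 : θ ≤ 0) :
    kappaTS β r θ ≤ 0 :=
  sub_nonpos.2 (Real.rpow_le_rpow hr (by linarith) hβ)

theorem kappaTS_self {β : ℝ} (hβ : β ≠ 0) (r : ℝ) : kappaTS β r r = r ^ β := by
  simp [kappaTS, Real.zero_rpow hβ]

theorem kappaTS_self_add_kappaTS_neg_pos {β r s : ℝ} (h0 : β ≠ 0) (h1 : β < 1) (hr : 0 < r)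
    (hs : 0 < s) : 0 < kappaTS β r r + kappaTS β s (-r) := by
  rw [kappaTS_self h0, kappaTS, sub_neg_eq_add, add_comm s r]
  linarith [Real.add_rpow_lt_rpow_add_rpow hr hs h1]

theorem PsiTS_eq_max_rpow {β r₁ r₂ θ : ℝ} (hβ : 0 ≤ β) (hr₁ : 0 ≤ r₁) (hr₂ : 0 ≤ r₂)
    (hθ : θ ∈ Set.Icc (-r₂) r₁) (ν : ℝ) :
    PsiTS β r₁ r₂ ν θ = (max (kappaTS β r₁ θ) (kappaTS β r₂ (-θ))) ^ (1 / ν) := by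
  unfold PsiTS
  split_ifs with h
  · rw [max_eq_left]
    exact (kappaTS_nonpos hβ hr₂ (by linarith)).trans (kappaTS_nonneg hβ h hθ.2)
  · rw [max_eq_right]
    exact (kappaTS_nonpos hβ hr₁ (by linarith)).trans
      (kappaTS_nonneg hβ (by linarith) (by linarith [hθ.1]))

theorem rate_function_comparison_TS_different_nu
    (β r₁ r₂ η ν : ℝ) (hβ : β ∈ Set.Ioo (0 : ℝ) 1) (hr₁ : 0 < r₁) (hr₂ : 0 < r₂)
    (hη : 0 < η) (hην : η < ν) (hν : ν < 1) :
    ∃ δ : ℝ, 0 < δ ∧ ∀ x : ℝ, 0 < |x| → |x| < δ →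
      (IrateTS β r₁ r₂ η x > IrateTS β r₁ r₂ ν x ∧ IrateTS β r₁ r₂ ν x > 0) ∧
      (JrateTS β r₁ r₂ η x > JrateTS β r₁ r₂ ν x ∧ JrateTS β r₁ r₂ ν x > 0) := by
  obtain ⟨hβ0, hβ1⟩ := hβ
  have hp : 1 < 1 / ν := (one_lt_div (hη.trans hην)).2 hν
  have hpq : 1 / ν < 1 / η := one_div_lt_one_div_of_lt hη hην
  have hconv₁ : ConvexOn ℝ (Set.Icc (-r₂) r₁) (kappaTS β r₁) :=
    (convexOn_kappaTS hβ0.le hβ1.le r₁).subset Set.Icc_subset_Iic_self (convex_Icc _ _)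
  have hconv₂ : ConvexOn ℝ (Set.Icc (-r₂) r₁) (fun θ => kappaTS β r₂ (-θ)) :=
    (convexOn_kappaTS_neg hβ0.le hβ1.le r₂).subset Set.Icc_subset_Ici_self (convex_Icc _ _)
  have hcont₁ : Continuous (kappaTS β r₁) := continuous_kappaTS hβ0.le r₁
  have hcont₂ : Continuous (fun θ => kappaTS β r₂ (-θ)) :=
    (continuous_kappaTS hβ0.le r₂).comp continuous_neg
  refine ⟨1 / (r₁ - -r₂), by apply one_div_pos.2; linarith, fun x hx0 hxδ => ?_⟩
  have hx : x ≠ 0 := abs_pos.1 hx0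
  have hx1 : (r₁ - -r₂) * |x| < 1 := by
    rwa [lt_div_iff₀ (by linarith), mul_comm] at hxδ
  constructor
  · refine iSup_mul_sub_rpow_lt
      (G := fun θ => max (kappaTS β r₁ θ + kappaTS β r₂ (-θ)) 0) (neg_neg_of_pos hr₂) hr₁
      ((hconv₁.add hconv₂).sup (convexOn_const 0 (convex_Icc _ _)))
      ((hcont₁.add hcont₂).max continuous_const).continuousOn
      (fun _ _ => le_max_right _ _) (by simp) (lt_max_of_lt_left ?_) (lt_max_of_lt_left ?_)
      hp hpq hx hx1
    · rw [neg_neg, add_comm]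
      exact kappaTS_self_add_kappaTS_neg_pos hβ0.ne' hβ1 hr₂ hr₁
    · exact kappaTS_self_add_kappaTS_neg_pos hβ0.ne' hβ1 hr₁ hr₂
  · have hJ : ∀ e : ℝ, JrateTS β r₁ r₂ e x = ⨆ θ : Set.Icc (-r₂) r₁,
        ((θ : ℝ) * x - (max (kappaTS β r₁ θ) (kappaTS β r₂ (-θ))) ^ (1 / e)) := fun e =>
      iSup_congr fun θ => by rw [PsiTS_eq_max_rpow hβ0.le hr₁.le hr₂.le θ.2]
    rw [hJ η, hJ ν]
    refine iSup_mul_sub_rpow_lt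
      (G := fun θ => max (kappaTS β r₁ θ) (kappaTS β r₂ (-θ))) (neg_neg_of_pos hr₂) hr₁
      (hconv₁.sup hconv₂) (hcont₁.max hcont₂).continuousOn
      (fun θ hθ => ?_) (by simp) (lt_max_of_lt_right ?_) (lt_max_of_lt_left ?_)
      hp hpq hx hx1
    · rcases le_total 0 θ with h | h
      · exact le_max_of_le_left (kappaTS_nonneg hβ0.le h hθ.2)
      · exact le_max_of_le_right
          (kappaTS_nonneg hβ0.le (by linarith) (by linarith [hθ.1]))
    · rw [neg_neg, kappaTS_self hβ0.ne']
      exact Real.rpow_pos_of_pos hr₂ β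
    · rw [kappaTS_self hβ0.ne']
      exact Real.rpow_pos_of_pos hr₁ β
end

section
/- Let β ∈ (0,1), r > 0, ν ∈ (0,1) and 0 < h < r^{β−1}. Define κ(θ) := r^β − (r−θ)^β − hθ for θ ≤ r. Then κ(r) > 0, and the derivative of the function θ ↦ (κ(θ))^{1/ν} tends to +∞ as θ tends to r from the left (i.e., the limit of d/dθ (r^β − (r−θ)^β − hθ)^{1/ν} along the left-neighborhood filter of r is +∞). -/
open Filter

theorem steepness_tempered_stable_minus_drift
    (β r ν h : ℝ) (hβ : β ∈ Set.Ioo (0 : ℝ) 1) (hr : 0 < r)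
    (hν : ν ∈ Set.Ioo (0 : ℝ) 1) (hh : 0 < h) (hhr : h < r ^ (β - 1)) :
    (r ^ β - (r - r) ^ β - h * r > 0) ∧
    Tendsto (deriv fun θ : ℝ => (r ^ β - (r - θ) ^ β - h * θ) ^ (1 / ν))
      (nhdsWithin r (Set.Iio r)) atTop := by
  obtain ⟨hβ0, hβ1⟩ := hβ
  obtain ⟨hν0, hν1⟩ := hν
  have hpos : r ^ β - (r - r) ^ β - h * r > 0 := by
    have hlt : h * r < r ^ (β - 1) * r := mul_lt_mul_of_pos_right hhr hr
    have heq : r ^ (β - 1) * r = r ^ β := by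
      rw [Real.rpow_sub_one hr.ne', div_mul_cancel₀ _ hr.ne']
    rw [sub_self, Real.zero_rpow hβ0.ne']
    linarith
  refine ⟨hpos, ?_⟩
  have hν' : 1 ≤ 1 / ν := by
    rw [le_div_iff₀ hν0]
    linarith
  have hcont : ContinuousAt (fun θ : ℝ => r ^ β - (r - θ) ^ β - h * θ) r := by
    have hrpow : ContinuousAt (fun θ : ℝ => (r - θ) ^ β) r :=
      (continuousAt_const.sub continuousAt_id).rpow_const (Or.inr hβ0.le)
    exact (continuousAt_const.sub hrpow).sub (continuousAt_const.mul continuousAt_id)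
  have hfactor : Tendsto
      (fun θ : ℝ => 1 / ν * (r ^ β - (r - θ) ^ β - h * θ) ^ (1 / ν - 1))
      (nhdsWithin r (Set.Iio r))
      (nhds (1 / ν * (r ^ β - (r - r) ^ β - h * r) ^ (1 / ν - 1))) :=
    ((hcont.rpow_const (Or.inl hpos.ne')).tendsto.const_mul _).mono_left nhdsWithin_le_nhds
  have hsub : Tendsto (fun θ : ℝ => r - θ) (nhdsWithin r (Set.Iio r))
      (nhdsWithin 0 (Set.Ioi 0)) := by
    refine tendsto_nhdsWithin_iff.mpr ⟨?_, ?_⟩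
    · have hc : Continuous fun θ : ℝ => r - θ := by fun_prop
      simpa using (hc.tendsto r).mono_left nhdsWithin_le_nhds
    · filter_upwards [self_mem_nhdsWithin] with θ hθ
      exact sub_pos.mpr (Set.mem_Iio.mp hθ)
  have hslope : Tendsto (fun θ : ℝ => β * (r - θ) ^ (β - 1) - h)
      (nhdsWithin r (Set.Iio r)) atTop :=
    tendsto_atTop_add_const_right _ (-h)
      (((tendsto_rpow_neg_nhdsGT_zero (sub_neg.mpr hβ1)).comp hsub).const_mul_atTop hβ0)
  have hprod := hslope.atTop_mul_pos
    (mul_pos (one_div_pos.mpr hν0) (Real.rpow_pos_of_pos hpos (1 / ν - 1))) hfactor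
  refine hprod.congr' ?_
  filter_upwards [self_mem_nhdsWithin] with θ hθ
  have hθr : r - θ ≠ 0 := (sub_pos.mpr (Set.mem_Iio.mp hθ)).ne'
  have hκ := ((((hasDerivAt_id θ).const_sub r).rpow_const (p := β) (Or.inl hθr)).const_sub
    (r ^ β)).sub ((hasDerivAt_id θ).const_mul h)
  have hd := hκ.rpow_const (p := 1 / ν) (Or.inr hν')
  refine Eq.trans ?_ hd.deriv.symm
  simp only [id, Pi.sub_apply]
  ring
end
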